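/- Let k be a field of characteristic zero, n ≥ 5, and let J ∈ M_n(k) be the nilpotent Jordan block (ones on the superdiagonal, zeros elsewhere). Let B ∈ M_n(k) satisfy JB − BJ = B², and suppose i is an integer with 2 ≤ i ≤ ⌊(n−1)/2⌋ such that B_{n−j,n} = 0 for all 1 ≤ j ≤ i−1 and B_{n−i,n} ≠ 0. Then for every integer t with i ≤ t ≤ 2i−2 and every integer j with 0 ≤ j ≤ n−t−1, one has B_{n−t−j, n−j} = B_{n−t,n}; that is, B_{n−t,n} = B_{n−t−1,n−1} = ⋯ = B_{1,t+1}. -/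

import Mathlib

open Matrix in
/-- Powers of the nilpotent Jordan block act on vectors as iterated shifts. -/
theorem jordan_pow_mulVec {k : Type*} [Field k] {n : ℕ} {J : Matrix (Fin n) (Fin n) k}
    (hJ : ∀ i j : Fin n, J i j = if (i : ℕ) + 1 = (j : ℕ) then 1 else 0)
    (m : ℕ) (v : Fin n → k) (a : Fin n) :
    (J ^ m *ᵥ v) a = if h : (a : ℕ) + m < n then v ⟨a + m, h⟩ else 0 := by
  induction m generalizing v with
  | zero => simp
  | succ m ih =>
    rw [pow_succ, ← mulVec_mulVec, ih]
    have key (b : Fin n) : (J *ᵥ v) b = if h : (b : ℕ) + 1 < n then v ⟨b + 1, h⟩ else 0 := by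
      simp only [mulVec, dotProduct, hJ, ite_mul, one_mul, zero_mul]
      split_ifs with h
      · rw [Finset.sum_eq_single ⟨b + 1, h⟩]
        · simp
        · intro c _ hc
          exact if_neg fun h' => hc (Fin.ext h'.symm)
        · simp
      · exact Finset.sum_eq_zero fun c _ => if_neg (by omega)
    by_cases h : (a : ℕ) + (m + 1) < n
    · rw [dif_pos h, dif_pos (by omega), key, dif_pos (by simp only; omega)]
      rfl
    · rw [dif_neg h]
      split_ifs with h'
      · rw [key, dif_neg (by simp only; omega)]
      · rfl

theorem jordan_pow_eq_zero {k : Type*} [Field k] {n : ℕ} {J : Matrix (Fin n) (Fin n) k}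
    (hJ : ∀ i j : Fin n, J i j = if (i : ℕ) + 1 = (j : ℕ) then 1 else 0) : J ^ n = 0 := by
  ext a b
  have := jordan_pow_mulVec hJ n (Pi.single b 1) a
  rw [dif_neg (by omega)] at this
  simpa using this

/-- A subspace invariant under the Jordan block that contains a vector with nonzero `a`-th
coordinate contains the basis vectors with index at most `a`. -/
theorem single_mem_of_jordan_invariant {k : Type*} [Field k] {n : ℕ}
    {J : Matrix (Fin n) (Fin n) k}
    (hJ : ∀ i j : Fin n, J i j = if (i : ℕ) + 1 = (j : ℕ) then 1 else 0)
    (W : Submodule k (Fin n → k)) (hW : ∀ v ∈ W, J.mulVec v ∈ W)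
    {v : Fin n → k} (hv : v ∈ W) {a b : Fin n} (ha : v a ≠ 0) (hb : b ≤ a) :
    Pi.single b 1 ∈ W := by
  obtain ⟨t, hat, ht⟩ := Set.Finite.exists_le_maximal (Set.toFinite {c | v c ≠ 0}) ha
  have hpow (m : ℕ) : (J ^ m).mulVec v ∈ W := by
    induction m with
    | zero => simpa
    | succ m ih =>
      rw [pow_succ', ← Matrix.mulVec_mulVec]
      exact hW _ ih
  have hbt : b ≤ t := hb.trans hat
  clear hb ha hat a
  induction b using WellFoundedLT.induction with
  | ind b ih =>
    set u := (J ^ ((t : ℕ) - b)).mulVec v with hu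
    have hub : u b = v t := by
      rw [hu, jordan_pow_mulVec hJ, dif_pos (by omega)]
      congr 1
      ext
      simp only
      omega
    have hsum : u = ∑ c, u c • Pi.single c (1 : k) := by
      ext d
      simp [Finset.sum_apply, Pi.single_apply]
    rw [← Finset.add_sum_erase _ _ (Finset.mem_univ b)] at hsum
    have hrest : ∑ c ∈ Finset.univ.erase b, u c • Pi.single c (1 : k) ∈ W := by
      refine W.sum_mem fun c hc => ?_
      rcases lt_or_gt_of_ne (Finset.ne_of_mem_erase hc) with h | h
      · exact W.smul_mem _ (ih c h (h.le.trans hbt))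
      · have : u c = 0 := by
          rw [hu, jordan_pow_mulVec hJ]
          split_ifs with h'
          · by_contra hne
            have hle := ht.2 hne (by rw [Fin.le_def]; simp only; omega)
            rw [Fin.le_def] at hle
            simp only at hle
            omega
          · rfl
        simp [this]
    have hsmul : u b • Pi.single b (1 : k) ∈ W := by
      rw [eq_sub_of_add_eq hsum.symm]
      exact W.sub_mem (hpow _) hrest
    exact (W.smul_mem_iff (hub ▸ ht.1)).1 hsmul

theorem commutator_pow_of_commutator_eq_sq {R : Type*} [Ring R] {J B : R}
    (hB : J * B - B * J = B ^ 2) (m : ℕ) :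
    J * B ^ m - B ^ m * J = m * B ^ (m + 1) := by
  induction m with
  | zero => simp
  | succ m ih =>
    calc J * B ^ (m + 1) - B ^ (m + 1) * J
        = (J * B ^ m - B ^ m * J) * B + B ^ m * (J * B - B * J) := by
          rw [pow_succ]; noncomm_ring
      _ = (m + 1 : ℕ) * B ^ (m + 1 + 1) := by
          rw [ih, hB, ← pow_add, mul_assoc, ← pow_succ]
          push_cast
          noncomm_ring

theorem isNilpotent_of_commutator_eq_sq {k R : Type*} [Field k] [CharZero k] [Ring R]
    [Algebra k R] {J B : R} (hJ : IsNilpotent J) (hB : J * B - B * J = B ^ 2) :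
    IsNilpotent B := by
  have hl : IsNilpotent (LinearMap.mulLeft k J) := by rwa [LinearMap.isNilpotent_mulLeft_iff]
  have hr : IsNilpotent (LinearMap.mulRight k J) := by rwa [LinearMap.isNilpotent_mulRight_iff]
  obtain ⟨N, hN⟩ := (LinearMap.commute_mulLeft_right J J).isNilpotent_sub hl hr
  have had (m : ℕ) : ((LinearMap.mulLeft k J - LinearMap.mulRight k J) ^ m) B =
      (m.factorial : k) • B ^ (m + 1) := by
    induction m with
    | zero => simp
    | succ m ih =>
      rw [pow_succ', Module.End.mul_apply, ih, map_smul, LinearMap.sub_apply,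
        LinearMap.mulLeft_apply, LinearMap.mulRight_apply,
        commutator_pow_of_commutator_eq_sq hB, Nat.factorial_succ, mul_comm (m + 1), Nat.cast_mul,
        mul_smul, ← nsmul_eq_mul, Nat.cast_smul_eq_nsmul k (m + 1)]
  refine ⟨N + 1, ?_⟩
  have h := had N
  rw [hN, LinearMap.zero_apply] at h
  exact (smul_eq_zero.1 h.symm).resolve_left (Nat.cast_ne_zero.2 N.factorial_ne_zero)

theorem strictUpper_of_jordan_commutator_eq_sq {k : Type*} [Field k] [CharZero k] {n : ℕ}
    {J B : Matrix (Fin n) (Fin n) k}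
    (hJ : ∀ i j : Fin n, J i j = if (i : ℕ) + 1 = (j : ℕ) then 1 else 0)
    (hB : J * B - B * J = B ^ 2) {a c : Fin n} (hca : c ≤ a) : B a c = 0 := by
  obtain ⟨N, hN⟩ := isNilpotent_of_commutator_eq_sq (k := k) ⟨n, jordan_pow_eq_zero hJ⟩ hB
  classical
  have hex : ∃ m, (B ^ m).mulVec (Pi.single c 1) = 0 := ⟨N, by rw [hN, Matrix.zero_mulVec]⟩
  obtain ⟨m, hm, hmin⟩ : ∃ m, (B ^ (m + 1)).mulVec (Pi.single c 1) = 0 ∧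
      (B ^ m).mulVec (Pi.single c 1) ≠ 0 := by
    have hpos : Nat.find hex ≠ 0 := fun h0 => by
      have := Nat.find_spec hex
      rw [h0, pow_zero, Matrix.one_mulVec] at this
      simp at this
    obtain ⟨m, hm⟩ := Nat.exists_eq_succ_of_ne_zero hpos
    refine ⟨m, ?_, Nat.find_min hex (by omega)⟩
    have := Nat.find_spec hex
    rwa [hm] at this
  by_contra hne
  refine hmin (single_mem_of_jordan_invariant hJ (LinearMap.ker (B ^ m).mulVecLin) ?_
    (v := B.mulVec (Pi.single c 1)) ?_ (a := a) ?_ hca)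
  · intro v hv
    rw [LinearMap.mem_ker, Matrix.mulVecLin_apply] at hv ⊢
    have h := commutator_pow_of_commutator_eq_sq hB m
    rw [pow_succ', ← mul_assoc, (Nat.cast_commute m B).eq, mul_assoc] at h
    rw [Matrix.mulVec_mulVec, ← sub_eq_iff_eq_add.2 (sub_eq_iff_eq_add'.1 h),
      Matrix.sub_mulVec, ← Matrix.mulVec_mulVec, ← Matrix.mulVec_mulVec, ← Matrix.mulVec_mulVec, hv]
    simp
  · rw [LinearMap.mem_ker, Matrix.mulVecLin_apply, Matrix.mulVec_mulVec, ← pow_succ]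
    exact hm
  · simpa using hne

/-- The entrywise form of `JB - BJ = B²`. -/
theorem jordan_commutator_entry {k : Type*} [Field k] {n : ℕ}
    {J B : Matrix (Fin n) (Fin n) k}
    (hJ : ∀ i j : Fin n, J i j = if (i : ℕ) + 1 = (j : ℕ) then 1 else 0)
    (hB : J * B - B * J = B ^ 2) {a c : ℕ} (ha : a + 1 < n) (hc : c + 1 < n) :
    B ⟨a + 1, ha⟩ ⟨c + 1, hc⟩ - B ⟨a, by omega⟩ ⟨c, by omega⟩ =
      ∑ d, B ⟨a, by omega⟩ d * B d ⟨c + 1, hc⟩ := by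
  have h := congrFun (congrFun hB ⟨a, by omega⟩) ⟨c + 1, hc⟩
  rw [Matrix.sub_apply, pow_two, Matrix.mul_apply, Matrix.mul_apply, Matrix.mul_apply] at h
  rw [← h]
  congr 1
  · rw [Finset.sum_eq_single ⟨a + 1, ha⟩]
    · simp [hJ]
    · intro d _ hd
      rw [hJ, if_neg fun h' => hd (Fin.ext h'.symm), zero_mul]
    · simp
  · rw [Finset.sum_eq_single ⟨c, by omega⟩]
    · simp [hJ]
    · intro d _ hd
      rw [hJ, if_neg fun h' => hd (Fin.ext (by simpa using h')), mul_zero]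
    · simp

/-- If the last entries of the first `i - 1` superdiagonals vanish, so do those
superdiagonals. -/
theorem superdiagonal_eq_zero {k : Type*} [Field k] [CharZero k] {n : ℕ}
    {J B : Matrix (Fin n) (Fin n) k}
    (hJ : ∀ i j : Fin n, J i j = if (i : ℕ) + 1 = (j : ℕ) then 1 else 0)
    (hB : J * B - B * J = B ^ 2) {i : ℕ}
    (hlast : ∀ a c : Fin n, (c : ℕ) + 1 = n → a < c → (c : ℕ) < a + i → B a c = 0)
    {s : ℕ} (hs : s < i) (a c : Fin n) (hca : (c : ℕ) ≤ a + s) : B a c = 0 := by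
  induction s generalizing a c with
  | zero => exact strictUpper_of_jordan_commutator_eq_sq hJ hB hca
  | succ s ih =>
    replace ih := ih (by omega)
    obtain h | h := Nat.lt_or_eq_of_le hca
    · exact ih a c (by omega)
    obtain ⟨j, hj⟩ : ∃ j, (c : ℕ) + 1 + j = n := ⟨n - (c + 1), by omega⟩
    induction j generalizing a c with
    | zero => exact hlast a c hj (by rw [Fin.lt_def]; omega) (by omega)
    | succ j ihj =>
      have hnext := ihj ⟨a + 1, by omega⟩ ⟨c + 1, by omega⟩ (by simp only; omega)
        (by simp only; omega) (by simp only; omega)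
      have hrel := jordan_commutator_entry hJ hB (a := a) (c := c) (by omega) (by omega)
      rw [hnext, Finset.sum_eq_zero, zero_sub, neg_eq_zero] at hrel
      · exact hrel
      · intro d _
        by_cases hd : (d : ℕ) ≤ a + s
        · rw [ih _ d hd, zero_mul]
        by_cases hd' : (c : ℕ) + 1 ≤ d + s
        · rw [ih d _ hd', mul_zero]
        have : d = ⟨a + 1, by omega⟩ := Fin.ext (by simp only; omega)
        rw [this, hnext, mul_zero]

theorem stmt_17 (k : Type*) [Field k] [CharZero k] (n : ℕ) (hn : 5 ≤ n)
    (J B : Matrix (Fin n) (Fin n) k)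
    (hJ : ∀ i j : Fin n, J i j = if (i : ℕ) + 1 = (j : ℕ) then 1 else 0)
    (hB : J * B - B * J = B ^ 2)
    (i : ℕ) (hi1 : 2 ≤ i) (hi2 : i ≤ (n - 1) / 2)
    (hzero : ∀ j : ℕ, 1 ≤ j → j ≤ i - 1 →
      B ⟨n - j - 1, by omega⟩ ⟨n - 1, by omega⟩ = 0)
    (hne : B ⟨n - i - 1, by omega⟩ ⟨n - 1, by omega⟩ ≠ 0) :
    ∀ (t : ℕ) (ht1 : i ≤ t) (ht2 : t ≤ 2 * i - 2) (j : ℕ) (hj : j ≤ n - t - 1),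
      B ⟨n - t - j - 1, by omega⟩ ⟨n - j - 1, by omega⟩ =
        B ⟨n - t - 1, by omega⟩ ⟨n - 1, by omega⟩ := by
  have hlast (a c : Fin n) (hc : (c : ℕ) + 1 = n) (hac : a < c) (hci : (c : ℕ) < a + i) :
      B a c = 0 := by
    rw [Fin.lt_def] at hac
    convert hzero (c - a) (by omega) (by omega) using 2 <;> ext <;> simp only <;> omega
  have hvanish (a c : Fin n) (h : (c : ℕ) < a + i) : B a c = 0 :=
    superdiagonal_eq_zero hJ hB hlast (s := i - 1) (by omega) a c (by omega)
  intro t ht1 ht2 j hj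
  induction j with
  | zero => rfl
  | succ j ih =>
    rw [← ih (by omega)]
    have hrel := jordan_commutator_entry hJ hB (a := n - t - (j + 1) - 1) (c := n - (j + 1) - 1)
      (by omega) (by omega)
    rw [Finset.sum_eq_zero, sub_eq_zero] at hrel
    · rw [← hrel]
      congr 2 <;> omega
    · intro d _
      by_cases hd : (d : ℕ) < n - t - (j + 1) - 1 + i
      · rw [hvanish _ d hd, zero_mul]
      · rw [hvanish d _ (by simp only; omega), mul_zero]
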